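/- Let 0 < λ < 2/√3 − 1 and set ℓ = 1 + λ. For each n, let δ_2(n, λ) be the supremum, over all packings c_1, …, c_n of n unit disks in E², of n·π / vol_2(⋃_{i=1}^n (c_i + ℓB²)). Then limsup_{n→∞} δ_2(n, λ) = π / vol_2(H ∩ ℓB²), where H is the regular hexagon centered at the origin circumscribed about the unit disk B². -/

import Mathlib

open MeasureTheory Metric

/-- The regular hexagon centered at the origin circumscribed about the unit disk `B²`
(inradius `1`, circumradius `2/√3`): the convex hull of its six vertices. -/
noncomputable def regularHexagon : Set (EuclideanSpace ℝ (Fin 2)) :=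
  convexHull ℝ (Set.range fun k : Fin 6 =>
    (WithLp.equiv 2 (Fin 2 → ℝ)).symm
      ![2 / Real.sqrt 3 * Real.cos ((k : ℝ) * (Real.pi / 3)),
        2 / Real.sqrt 3 * Real.sin ((k : ℝ) * (Real.pi / 3))])

/-- `δ₂(n, λ)`: the supremum, over all packings `c` of `n` unit disks in `E²`, of
`n·π / vol₂(⋃ (c i + (1+λ)B²))`. -/
noncomputable def deltaTwo (n : ℕ) (lam : ℝ) : ℝ :=
  sSup {x : ℝ | ∃ c : Fin n → EuclideanSpace ℝ (Fin 2),
    (∀ j k : Fin n, j ≠ k → 2 ≤ ‖c j - c k‖) ∧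
    x = (n : ℝ) * Real.pi / (volume (⋃ i : Fin n, closedBall (c i) (1 + lam))).toReal}

def capSet (l : ℝ) (v : EuclideanSpace ℝ (Fin 2)) : Set (EuclideanSpace ℝ (Fin 2)) :=
  {z | ‖z‖ ≤ l ∧ ‖z - v‖ ≤ ‖z‖}

def stdCap (l h : ℝ) : Set (EuclideanSpace ℝ (Fin 2)) := {z | ‖z‖ ≤ l ∧ h ≤ z 0}

lemma nsq (z : EuclideanSpace ℝ (Fin 2)) : ‖z‖ ^ 2 = z 0 ^ 2 + z 1 ^ 2 := by
  rw [EuclideanSpace.norm_sq_eq]; simp [Fin.sum_univ_two]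

lemma norm_sub_le_iff (z v : EuclideanSpace ℝ (Fin 2)) :
    ‖z - v‖ ≤ ‖z‖ ↔ ‖v‖ ^ 2 ≤ 2 * inner ℝ z v := by
  rw [← sq_le_sq₀ (norm_nonneg _) (norm_nonneg _), @norm_sub_sq ℝ]
  simp only [RCLike.re_to_real]
  constructor <;> intro h <;> linarith

lemma exists_iso (v : EuclideanSpace ℝ (Fin 2)) :
    ∃ φ : EuclideanSpace ℝ (Fin 2) ≃ₗᵢ[ℝ] EuclideanSpace ℝ (Fin 2),
      φ v = ‖v‖ • EuclideanSpace.single (0 : Fin 2) (1 : ℝ) := by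
  refine ⟨_, Submodule.reflection_sub (v := v)
    (w := ‖v‖ • EuclideanSpace.single (0 : Fin 2) (1 : ℝ)) ?_⟩
  simp [norm_smul]

lemma meas_stdCap (l h : ℝ) : MeasurableSet (stdCap l h) := by
  apply IsClosed.measurableSet
  apply IsClosed.inter
  · exact isClosed_le continuous_norm continuous_const
  · exact isClosed_le continuous_const (g := fun z : EuclideanSpace ℝ (Fin 2) => z 0) (by fun_prop)

lemma meas_capSet (l : ℝ) (v) : MeasurableSet (capSet l v) := by
  apply IsClosed.measurableSet
  apply IsClosed.inter
  · exact isClosed_le continuous_norm continuous_const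
  · exact isClosed_le (f := fun z : EuclideanSpace ℝ (Fin 2) => ‖z - v‖) (g := fun z => ‖z‖) (by fun_prop) (by fun_prop)

lemma iso_pre (l : ℝ) (v : EuclideanSpace ℝ (Fin 2)) (hv : 0 < ‖v‖)
    (φ : EuclideanSpace ℝ (Fin 2) ≃ₗᵢ[ℝ] EuclideanSpace ℝ (Fin 2))
    (hφ : φ v = ‖v‖ • EuclideanSpace.single (0 : Fin 2) (1 : ℝ))
    (z : EuclideanSpace ℝ (Fin 2)) : inner ℝ z v = ‖v‖ * (φ z) 0 := by
  rw [← φ.inner_map_map z v, hφ, inner_smul_right]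
  simp [EuclideanSpace.inner_single_right]

lemma cap_vol (l : ℝ) (v : EuclideanSpace ℝ (Fin 2)) (hv : 0 < ‖v‖) :
    volume (capSet l v) = volume (stdCap l (‖v‖ / 2)) := by
  obtain ⟨φ, hφ⟩ := exists_iso v
  have : capSet l v = φ ⁻¹' (stdCap l (‖v‖ / 2)) := by
    ext z
    simp only [capSet, stdCap, Set.mem_ofPred_eq, Set.mem_preimage, φ.norm_map,
      norm_sub_le_iff, iso_pre l v hv φ hφ z]
    refine and_congr_right fun _ => ?_
    constructor
    · intro h
      have : ‖v‖ * ‖v‖ ≤ ‖v‖ * (2 * φ z 0) := by nlinarith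
      have := le_of_mul_le_mul_left this hv
      linarith
    · intro h
      nlinarith
  rw [this, φ.measurePreserving.measure_preimage (meas_stdCap _ _).nullMeasurableSet]

lemma line_null (v : EuclideanSpace ℝ (Fin 2)) (hv : 0 < ‖v‖) :
    volume {z : EuclideanSpace ℝ (Fin 2) | ‖z - v‖ = ‖z‖} = 0 := by
  obtain ⟨φ, hφ⟩ := exists_iso v
  have h0 : volume {z : EuclideanSpace ℝ (Fin 2) | z 0 = ‖v‖ / 2} = 0 := by
    have h1 := Measure.pi_hyperplane (fun _ : Fin 2 => (volume : Measure ℝ)) 0 (‖v‖ / 2)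
    have h2 := (PiLp.volume_preserving_ofLp (Fin 2)).measure_preimage
      (s := {f : Fin 2 → ℝ | f 0 = ‖v‖ / 2})
      (by apply MeasurableSet.nullMeasurableSet
          exact (isClosed_eq (by fun_prop) continuous_const).measurableSet)
    rw [← volume_pi] at h1
    rw [h1] at h2
    exact h2
  have : {z : EuclideanSpace ℝ (Fin 2) | ‖z - v‖ = ‖z‖} = φ ⁻¹' {z | z 0 = ‖v‖ / 2} := by
    ext z
    simp only [Set.mem_ofPred_eq, Set.mem_preimage]
    rw [← sq_eq_sq₀ (norm_nonneg _) (norm_nonneg _), @norm_sub_sq ℝ]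
    simp only [RCLike.re_to_real, iso_pre 0 v hv φ hφ z]
    constructor
    · intro h
      have : ‖v‖ * ‖v‖ = ‖v‖ * (2 * φ z 0) := by nlinarith
      have := mul_left_cancel₀ hv.ne' this
      linarith
    · intro h
      rw [h]; ring
  rw [this, φ.measurePreserving.measure_preimage, h0]
  apply MeasurableSet.nullMeasurableSet
  exact (isClosed_eq (by fun_prop) continuous_const).measurableSet

def strip (l a b : ℝ) : Set (EuclideanSpace ℝ (Fin 2)) := {z | ‖z‖ ≤ l ∧ a ≤ z 0 ∧ z 0 < b}

lemma strip_shift (l a b t : ℝ) (ha : 0 ≤ a) (ht : 0 ≤ t) :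
    volume (strip l (a + t) (b + t)) ≤ volume (strip l a b) := by
  have h : strip l (a + t) (b + t) ⊆
      (fun z => z + (-(t • EuclideanSpace.single (0 : Fin 2) (1 : ℝ)))) ⁻¹' (strip l a b) := by
    rintro z ⟨h1, h2, h3⟩
    have e0 : (z + (-(t • EuclideanSpace.single (0 : Fin 2) (1 : ℝ)))) 0 = z 0 - t := by
      simp; ring
    have e1 : (z + (-(t • EuclideanSpace.single (0 : Fin 2) (1 : ℝ)))) 1 = z 1 := by
      simp
    refine ⟨?_, ?_, ?_⟩
    · refine le_trans ?_ h1
      rw [← sq_le_sq₀ (norm_nonneg _) (norm_nonneg _), nsq, nsq z, e0, e1]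
      nlinarith
    · rw [e0]; linarith
    · rw [e0]; linarith
  calc _ ≤ _ := measure_mono h
    _ = _ := measure_preimage_add_right _ _ _

lemma cap_ratio (l h : ℝ) (hl : l < 1.175) (hh : 1.025 ≤ h) :
    7 * volume (stdCap l h) ≤ 6 * volume (stdCap l 1) := by
  have hmono : volume (stdCap l h) ≤ volume (stdCap l 1.025) :=
    measure_mono fun z hz => ⟨hz.1, hh.trans hz.2⟩
  have hs : stdCap l 1 = strip l 1 1.025 ∪ stdCap l 1.025 := by
    ext z
    simp only [stdCap, strip, Set.mem_ofPred_eq, Set.mem_union]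
    constructor
    · rintro ⟨h1, h2⟩
      by_cases h3 : z 0 < 1.025
      · left; exact ⟨h1, h2, h3⟩
      · right; exact ⟨h1, not_lt.1 h3⟩
    · rintro (⟨h1, h2, h3⟩ | ⟨h1, h2⟩)
      · exact ⟨h1, h2⟩
      · exact ⟨h1, by linarith⟩
  have hd : Disjoint (strip l 1 1.025) (stdCap l 1.025) := by
    rw [Set.disjoint_left]
    rintro z ⟨_, _, h3⟩ ⟨_, h2⟩
    linarith
  have hv : volume (stdCap l 1) = volume (strip l 1 1.025) + volume (stdCap l 1.025) := by
    rw [hs, measure_union hd (meas_stdCap _ _)]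
  have hc : stdCap l 1.025 ⊆ ⋃ k : Fin 6,
      strip l (1 + 0.025 * ((k : ℝ) + 1)) (1.025 + 0.025 * ((k : ℝ) + 1)) := by
    rintro z ⟨h1, h2⟩
    have h3 : z 0 < 1.175 := by
      have : ‖z 0‖ ≤ ‖z‖ := PiLp.norm_apply_le z 0
      rw [Real.norm_eq_abs] at this
      linarith [le_abs_self (z 0)]
    simp only [Set.mem_iUnion, Fin.exists_fin_succ, strip, Set.mem_ofPred_eq]
    by_contra hcon
    simp [Fin.val_succ, h1] at hcon
    norm_num at hcon h3 h2
    obtain ⟨a, b, c, d, e, f⟩ := hcon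
    have := a h2
    have := b this
    have := c this
    have := d this
    have := e this
    have := f this
    linarith
  have h6 : volume (stdCap l 1.025) ≤ 6 * volume (strip l 1 1.025) := by
    calc _ ≤ _ := measure_mono hc
      _ ≤ ∑ k : Fin 6, volume (strip l (1 + 0.025 * ((k : ℝ) + 1)) (1.025 + 0.025 * ((k : ℝ) + 1))) :=
        measure_iUnion_fintype_le _ _
      _ ≤ ∑ k : Fin 6, volume (strip l 1 1.025) := by
        apply Finset.sum_le_sum
        intro k _
        apply strip_shift
        · norm_num
        · positivity
      _ = _ := by simp
  calc 7 * volume (stdCap l h) ≤ 7 * volume (stdCap l 1.025) := by gcongr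
    _ = volume (stdCap l 1.025) + 6 * volume (stdCap l 1.025) := by ring
    _ ≤ 6 * volume (strip l 1 1.025) + 6 * volume (stdCap l 1.025) := by gcongr
    _ = _ := by rw [hv]; ring

lemma arcs {ι : Type*} (s : Finset ι) (θ a : ι → ℝ) (ha : ∀ i ∈ s, 0 ≤ a i ∧ a i ≤ 1)
    (h : ∀ i ∈ s, ∀ j ∈ s, i ≠ j → Real.cos (θ i - θ j) < Real.cos (a i + a j)) :
    ∑ i ∈ s, a i ≤ Real.pi := by
  have : Fact (0 < 2 * Real.pi) := ⟨by positivity⟩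
  have hpi := Real.pi_gt_three
  have hd : Set.PairwiseDisjoint (s : Set ι)
      (fun i => closedBall ((θ i : ℝ) : AddCircle (2 * Real.pi)) (a i)) := by
    intro i hi j hj hij
    apply closedBall_disjoint_closedBall
    by_contra hcon
    rw [not_lt] at hcon
    rw [dist_eq_norm, ← AddCircle.coe_sub, AddCircle.norm_eq] at hcon
    have h1 := h i hi j hj hij
    have h2 : Real.cos |θ i - θ j - (round ((2 * Real.pi)⁻¹ * (θ i - θ j)) : ℤ) * (2 * Real.pi)|
        = Real.cos (θ i - θ j) := by
      rw [Real.cos_abs, Real.cos_sub_int_mul_two_pi]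
    have h3 := Real.cos_le_cos_of_nonneg_of_le_pi (abs_nonneg _)
      (by linarith [(ha i hi).2, (ha j hj).2]) hcon
    linarith
  have hm := measure_biUnion_finset (μ := (volume : Measure (AddCircle (2 * Real.pi)))) hd
    (fun i _ => measurableSet_closedBall)
  have hle : volume (⋃ i ∈ s, closedBall ((θ i : ℝ) : AddCircle (2 * Real.pi)) (a i))
      ≤ ENNReal.ofReal (2 * Real.pi) := by
    rw [← AddCircle.measure_univ]; exact measure_mono (Set.subset_univ _)
  rw [hm] at hle
  have : ∑ i ∈ s, volume (closedBall ((θ i : ℝ) : AddCircle (2 * Real.pi)) (a i)) =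
      ENNReal.ofReal (∑ i ∈ s, 2 * a i) := by
    rw [ENNReal.ofReal_sum_of_nonneg (fun i hi => by linarith [(ha i hi).1])]
    apply Finset.sum_congr rfl
    intro i hi
    rw [AddCircle.volume_closedBall, min_eq_right (by linarith [(ha i hi).2])]
  rw [this, ENNReal.ofReal_le_ofReal_iff (by positivity), ← Finset.mul_sum] at hle
  linarith

lemma cos_lower (x c : ℝ) (hx0 : 0 ≤ x) (hx : x ≤ 1) (hc : 0 ≤ 1 - (x/4)^2/2 - (x/4)^4*(5/96))
    (hc1 : 0 ≤ 2 * (1 - (x/4)^2/2 - (x/4)^4*(5/96))^2 - 1)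
    (h : c < 2 * (2 * (1 - (x/4)^2/2 - (x/4)^4*(5/96))^2 - 1)^2 - 1) : c < Real.cos x := by
  have h1 := (abs_le.1 (Real.cos_bound (x := x / 4) (by rw [abs_of_nonneg] <;> linarith))).1
  rw [abs_of_nonneg (by linarith : 0 ≤ x / 4)] at h1
  set b := 1 - (x/4)^2/2 - (x/4)^4*(5/96) with hb
  have h2 : b ≤ Real.cos (x / 4) := by linarith
  have h3 : Real.cos (x / 2) = 2 * Real.cos (x / 4) ^ 2 - 1 := by
    rw [← Real.cos_two_mul]; congr 1; ring
  have h4 : Real.cos x = 2 * Real.cos (x / 2) ^ 2 - 1 := by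
    rw [← Real.cos_two_mul]; congr 1; ring
  have h5 : b ^ 2 ≤ Real.cos (x / 4) ^ 2 := by gcongr
  have h6 : (2 * b ^ 2 - 1) ^ 2 ≤ Real.cos (x / 2) ^ 2 := by
    rw [h3]; gcongr
  rw [h4]; linarith

lemma cos89 : 0.626 < Real.cos 0.89 := by
  apply cos_lower <;> norm_num
lemma cos935 : 0.589 < Real.cos 0.935 := by
  apply cos_lower <;> norm_num
lemma cos98 : 0.55 < Real.cos 0.98 := by
  apply cos_lower <;> norm_num

noncomputable def wt (d : ℝ) : ℝ := if d ≤ 2.05 then 0.49 else 0.445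

lemma wt_bounds (d : ℝ) : 0.445 ≤ wt d ∧ wt d ≤ 0.49 := by
  unfold wt; split_ifs <;> norm_num

lemma wt_pair (d e x : ℝ) (hd : 2 ≤ d) (hd' : d ≤ 2.31) (he : 2 ≤ e) (he' : e ≤ 2.31)
    (h : 2 * d * e * x ≤ d ^ 2 + e ^ 2 - 4) : x < Real.cos (wt d + wt e) := by
  have hpos : 0 < 2 * d * e := by positivity
  have key : ∀ B : ℝ, d ^ 2 + e ^ 2 - 4 ≤ B * (2 * d * e) → x ≤ B := by
    intro B hB
    by_contra hc
    rw [not_le] at hc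
    nlinarith
  unfold wt
  split_ifs with h1 h2 h2
  · norm_num at *
    refine lt_of_le_of_lt (key 0.55 ?_) (by have := cos98; norm_num at *; linarith)
    nlinarith [mul_nonneg (sub_nonneg.2 hd) (sub_nonneg.2 h1), mul_nonneg (sub_nonneg.2 he) (sub_nonneg.2 h2),
      mul_nonneg (sub_nonneg.2 hd) (sub_nonneg.2 he)]
  · norm_num at *
    refine lt_of_le_of_lt (key 0.589 ?_) (by have := cos935; norm_num at *; linarith)
    nlinarith [mul_nonneg (sub_nonneg.2 hd) (sub_nonneg.2 h1), mul_nonneg (sub_nonneg.2 he) (sub_nonneg.2 he'),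
      mul_nonneg (sub_nonneg.2 hd) (sub_nonneg.2 he), mul_nonneg (sub_nonneg.2 h1) (sub_nonneg.2 he'), mul_nonneg (sub_nonneg.2 h1) (sub_nonneg.2 he), mul_nonneg (sub_nonneg.2 hd) (sub_nonneg.2 he')]
  · norm_num at *
    refine lt_of_le_of_lt (key 0.589 ?_) (by have := cos935; norm_num at *; linarith)
    nlinarith [mul_nonneg (sub_nonneg.2 hd) (sub_nonneg.2 hd'), mul_nonneg (sub_nonneg.2 he) (sub_nonneg.2 h2),
      mul_nonneg (sub_nonneg.2 hd) (sub_nonneg.2 he), mul_nonneg (sub_nonneg.2 hd') (sub_nonneg.2 h2), mul_nonneg (sub_nonneg.2 hd') (sub_nonneg.2 he), mul_nonneg (sub_nonneg.2 hd) (sub_nonneg.2 h2)]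
  · norm_num at *
    refine lt_of_le_of_lt (key 0.626 ?_) (by have := cos89; norm_num at *; linarith)
    nlinarith [mul_nonneg (sub_nonneg.2 hd) (sub_nonneg.2 hd'), mul_nonneg (sub_nonneg.2 he) (sub_nonneg.2 he'),
      mul_nonneg (sub_nonneg.2 hd) (sub_nonneg.2 he), mul_nonneg (sub_nonneg.2 hd') (sub_nonneg.2 he'), mul_nonneg (sub_nonneg.2 hd') (sub_nonneg.2 he), mul_nonneg (sub_nonneg.2 hd) (sub_nonneg.2 he')]

noncomputable def ang (z : EuclideanSpace ℝ (Fin 2)) : ℝ := Complex.arg ⟨z 0, z 1⟩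

lemma polar (z : EuclideanSpace ℝ (Fin 2)) :
    z 0 = ‖z‖ * Real.cos (ang z) ∧ z 1 = ‖z‖ * Real.sin (ang z) := by
  have : ‖z‖ = ‖(⟨z 0, z 1⟩ : ℂ)‖ := by
    rw [← sq_eq_sq₀ (norm_nonneg _) (norm_nonneg _), nsq, Complex.sq_norm, Complex.normSq_mk]
    ring
  rw [this, ang, Complex.norm_mul_cos_arg, Complex.norm_mul_sin_arg]
  exact ⟨rfl, rfl⟩

lemma sum_wt {ι : Type*} (s : Finset ι) (v : ι → EuclideanSpace ℝ (Fin 2))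
    (h2 : ∀ i ∈ s, 2 ≤ ‖v i‖) (h3 : ∀ i ∈ s, ‖v i‖ ≤ 2.31)
    (hp : ∀ i ∈ s, ∀ j ∈ s, i ≠ j → 2 ≤ ‖v i - v j‖) :
    ∑ i ∈ s, wt ‖v i‖ ≤ Real.pi := by
  apply arcs s (fun i => ang (v i))
  · intro i _
    have := wt_bounds ‖v i‖
    constructor <;> linarith [this.1, this.2]
  · intro i hi j hj hij
    apply wt_pair _ _ _ (h2 i hi) (h3 i hi) (h2 j hj) (h3 j hj)
    have h := hp i hi j hj hij
    have h4 : 2 ^ 2 ≤ ‖v i - v j‖ ^ 2 := by gcongr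
    rw [nsq] at h4
    obtain ⟨a, b⟩ := polar (v i)
    obtain ⟨c, d⟩ := polar (v j)
    have e := nsq (v i)
    have f := nsq (v j)
    rw [Real.cos_sub]
    have : 2 * ‖v i‖ * ‖v j‖ * (Real.cos (ang (v i)) * Real.cos (ang (v j)) +
        Real.sin (ang (v i)) * Real.sin (ang (v j))) = 2 * (v i 0 * v j 0 + v i 1 * v j 1) := by
      rw [a, b, c, d]; ring
    rw [this, e, f]
    simp only [PiLp.sub_apply] at h4
    nlinarith

lemma local_bound (l : ℝ) (hl : l < 1.155) {ι : Type*} (s : Finset ι)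
    (v : ι → EuclideanSpace ℝ (Fin 2)) (h2 : ∀ i ∈ s, 2 ≤ ‖v i‖)
    (hp : ∀ i ∈ s, ∀ j ∈ s, i ≠ j → 2 ≤ ‖v i - v j‖) :
    ∑ i ∈ s, volume (capSet l (v i)) ≤ 6 * volume (stdCap l 1) := by
  classical
  have hz : ∀ i ∈ s, ¬ (‖v i‖ ≤ 2.31) → volume (capSet l (v i)) = 0 := by
    intro i _ h
    have : capSet l (v i) = ∅ := by
      ext z
      simp only [capSet, Set.mem_ofPred_eq, Set.mem_empty_iff_false, iff_false, not_and]
      intro h1 h3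
      have := norm_sub_norm_le (v i) z
      rw [norm_sub_rev] at this
      rw [not_le] at h
      norm_num at *
      linarith
    rw [this]; simp
  rw [← Finset.sum_filter_of_ne (p := fun i => ‖v i‖ ≤ 2.31)
    (fun i hi h => by by_contra hc; exact h (hz i hi hc))]
  set t := s.filter (fun i => ‖v i‖ ≤ 2.31) with ht
  have hts : ∀ i ∈ t, i ∈ s ∧ ‖v i‖ ≤ 2.31 := fun i hi => by simpa [ht] using hi
  have hw := sum_wt t v (fun i hi => h2 i (hts i hi).1) (fun i hi => (hts i hi).2)
    (fun i hi j hj => hp i (hts i hi).1 j (hts j hj).1)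
  have hcv : ∀ i ∈ t, volume (capSet l (v i)) = volume (stdCap l (‖v i‖ / 2)) := fun i hi =>
    cap_vol l (v i) (by linarith [h2 i (hts i hi).1])
  have hpi := Real.pi_lt_d2
  by_cases h6 : t.card ≤ 6
  · calc _ ≤ ∑ i ∈ t, volume (stdCap l 1) := by
          apply Finset.sum_le_sum
          intro i hi
          rw [hcv i hi]
          refine measure_mono fun z hz => ⟨hz.1, ?_⟩
          linarith [hz.2, h2 i (hts i hi).1]
      _ = t.card * volume (stdCap l 1) := by simp
      _ ≤ _ := by gcongr; exact_mod_cast h6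
  · have h7 : t.card ≤ 7 := by
      by_contra hc
      have h8 : (8 : ℝ) ≤ t.card := by exact_mod_cast (not_le.1 hc)
      have : ∑ i ∈ t, (0.445 : ℝ) ≤ ∑ i ∈ t, wt ‖v i‖ :=
        Finset.sum_le_sum fun i _ => (wt_bounds _).1
      simp only [Finset.sum_const, nsmul_eq_mul] at this
      norm_num at hpi this
      linarith
    have hc7 : t.card = 7 := by omega
    have hbig : ∀ i ∈ t, 2.05 < ‖v i‖ := by
      intro i hi
      by_contra hc
      rw [not_lt] at hc
      rw [← Finset.add_sum_erase _ _ hi] at hw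
      have : ∑ i ∈ t.erase i, (0.445 : ℝ) ≤ ∑ i ∈ t.erase i, wt ‖v i‖ :=
        Finset.sum_le_sum fun i _ => (wt_bounds _).1
      simp only [Finset.sum_const, nsmul_eq_mul, Finset.card_erase_of_mem hi, hc7] at this
      rw [wt, if_pos hc] at hw
      norm_num at *
      linarith
    have h71 : ∀ i ∈ t, 7 * volume (capSet l (v i)) ≤ 6 * volume (stdCap l 1) := by
      intro i hi
      rw [hcv i hi]
      have := hbig i hi
      exact cap_ratio l _ (by norm_num at *; linarith) (by norm_num at *; linarith)
    have hs : 7 * ∑ i ∈ t, volume (capSet l (v i)) ≤ 7 * (6 * volume (stdCap l 1)) := by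
      rw [Finset.mul_sum]
      calc _ ≤ ∑ i ∈ t, 6 * volume (stdCap l 1) := Finset.sum_le_sum h71
        _ = _ := by simp [hc7]
    exact (ENNReal.mul_le_mul_iff_right (by norm_num) (by norm_num)).1 hs

noncomputable def hv : Fin 6 → EuclideanSpace ℝ (Fin 2) :=
  ![!₂[2 * (√3 / 3), 0], !₂[√3 / 3, 1], !₂[-(√3 / 3), 1], !₂[-(2 * (√3 / 3)), 0],
    !₂[-(√3 / 3), -1], !₂[√3 / 3, -1]]

lemma s3 : √3 * √3 = (3 : ℝ) := Real.mul_self_sqrt (by norm_num)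
lemma s3pos : (0 : ℝ) < √3 := by positivity

lemma hex_eq : regularHexagon = convexHull ℝ (Set.range hv) := by
  unfold regularHexagon
  congr 2
  have e : 2 / √3 = 2 * (√3 / 3 : ℝ) := by
    rw [div_eq_iff s3pos.ne']; linarith [s3]
  have hq : 2 * (√3 / 3) * (√3 / 2) = (1 : ℝ) := by linarith [s3]
  have c2 : Real.cos (2 * (Real.pi / 3)) = -(1 / 2) := by
    rw [show 2 * (Real.pi / 3) = Real.pi - Real.pi / 3 by ring, Real.cos_pi_sub]; simp
  have n2 : Real.sin (2 * (Real.pi / 3)) = √3 / 2 := by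
    rw [show 2 * (Real.pi / 3) = Real.pi - Real.pi / 3 by ring, Real.sin_pi_sub]; simp
  have c4 : Real.cos (4 * (Real.pi / 3)) = -(1 / 2) := by
    rw [show 4 * (Real.pi / 3) = Real.pi / 3 + Real.pi by ring, Real.cos_add_pi]; simp
  have n4 : Real.sin (4 * (Real.pi / 3)) = -(√3 / 2) := by
    rw [show 4 * (Real.pi / 3) = Real.pi / 3 + Real.pi by ring, Real.sin_add_pi]; simp
  have c5 : Real.cos (5 * (Real.pi / 3)) = 1 / 2 := by
    rw [show 5 * (Real.pi / 3) = 2 * Real.pi - Real.pi / 3 by ring, Real.cos_two_pi_sub]; simp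
  have n5 : Real.sin (5 * (Real.pi / 3)) = -(√3 / 2) := by
    rw [show 5 * (Real.pi / 3) = 2 * Real.pi - Real.pi / 3 by ring, Real.sin_two_pi_sub]; simp
  have c3 : Real.cos (3 * (Real.pi / 3)) = -1 := by
    rw [show 3 * (Real.pi / 3) = Real.pi by ring, Real.cos_pi]
  have n3 : Real.sin (3 * (Real.pi / 3)) = 0 := by
    rw [show 3 * (Real.pi / 3) = Real.pi by ring, Real.sin_pi]
  funext k
  rw [e]
  ext i
  fin_cases k <;> fin_cases i <;>
    simp [hv, c2, c3, c4, c5, n2, n3, n4, n5] <;> linarith [s3]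

lemma hex_convex : Convex ℝ regularHexagon := convex_convexHull ℝ _

lemma hex_closed : IsClosed regularHexagon := by
  rw [hex_eq]
  exact (Set.finite_range hv).isClosed_convexHull ℝ

lemma hv_mem (k : Fin 6) : hv k ∈ regularHexagon := by
  rw [hex_eq]; exact subset_convexHull ℝ _ ⟨k, rfl⟩

lemma hex_half (a b : ℝ) (h : ∀ k, a * hv k 0 + b * hv k 1 ≤ 2)
    (z : EuclideanSpace ℝ (Fin 2)) (hz : z ∈ regularHexagon) : a * z 0 + b * z 1 ≤ 2 := by
  have hc : Convex ℝ {z : EuclideanSpace ℝ (Fin 2) | a * z 0 + b * z 1 ≤ 2} := by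
    intro x hx y hy s t hs ht hst
    simp only [Set.mem_ofPred_eq, PiLp.add_apply, PiLp.smul_apply, smul_eq_mul] at *
    have : t = 1 - s := by linarith
    subst this
    nlinarith
  rw [hex_eq] at hz
  exact convexHull_min (by rintro _ ⟨k, rfl⟩; exact h k) hc hz

lemma rect (P Q P' Q' : EuclideanSpace ℝ (Fin 2)) (hP : P ∈ regularHexagon)
    (hQ : Q ∈ regularHexagon) (hP' : P' ∈ regularHexagon) (hQ' : Q' ∈ regularHexagon)
    (s t : ℝ) (hs : |s| ≤ 1) (ht : |t| ≤ 1) :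
    ((1 + s) / 2) • (((1 + t) / 2) • P + ((1 - t) / 2) • Q) +
    ((1 - s) / 2) • (((1 + t) / 2) • Q' + ((1 - t) / 2) • P') ∈ regularHexagon := by
  rw [abs_le] at hs ht
  refine hex_convex (hex_convex hP hQ ?_ ?_ ?_) (hex_convex hQ' hP' ?_ ?_ ?_) ?_ ?_ ?_ <;> linarith

lemma rect1 (z : EuclideanSpace ℝ (Fin 2)) (h1 : |z 1| ≤ 1) (h2 : |√3 * z 0| ≤ 1) :
    z ∈ regularHexagon := by
  convert rect _ _ _ _ (hv_mem 1) (hv_mem 2) (hv_mem 4) (hv_mem 5) _ _ h1 h2 using 1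
  ext i
  fin_cases i <;> simp [hv]
  · linear_combination (z 0 / 3) * -s3
  · ring

lemma rect0 (z : EuclideanSpace ℝ (Fin 2)) (h1 : |(√3 * z 0 + z 1) / 2| ≤ 1)
    (h2 : |(√3 * z 0 - 3 * z 1) / 2| ≤ 1) : z ∈ regularHexagon := by
  convert rect _ _ _ _ (hv_mem 0) (hv_mem 1) (hv_mem 3) (hv_mem 4) _ _ h1 h2 using 1
  ext i
  fin_cases i <;> simp [hv]
  · linear_combination (z 0 / 3) * -s3
  · ring

lemma rect2 (z : EuclideanSpace ℝ (Fin 2)) (h1 : |(-(√3 * z 0) + z 1) / 2| ≤ 1)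
    (h2 : |(-(√3 * z 0) - 3 * z 1) / 2| ≤ 1) : z ∈ regularHexagon := by
  convert rect _ _ _ _ (hv_mem 3) (hv_mem 2) (hv_mem 0) (hv_mem 5) _ _ h1 h2 using 1
  ext i
  fin_cases i <;> simp [hv]
  · linear_combination (z 0 / 3) * -s3
  · ring

noncomputable def lat (a b : ℤ) : EuclideanSpace ℝ (Fin 2) := !₂[√3 * a, a + 2 * b]

lemma cover_core (l : ℝ) (hl0 : 0 ≤ l) (hl : 3 * l ^ 2 < 4) (z : EuclideanSpace ℝ (Fin 2)) (hz : ‖z‖ ≤ l) :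
    ∃ a b : ℤ, |a| ≤ 1 ∧ |b| ≤ 1 ∧ z - lat a b ∈ regularHexagon ∧ ‖z - lat a b‖ ≤ l := by
  have hn : ‖z‖ ^ 2 ≤ l ^ 2 := by gcongr
  rw [nsq] at hn
  obtain ⟨X, hX⟩ : ∃ X, X = √3 * z 0 := ⟨_, rfl⟩
  obtain ⟨y, hy⟩ : ∃ y, y = z 1 := ⟨_, rfl⟩
  have hXs : X ^ 2 = 3 * z 0 ^ 2 := by rw [hX]; linear_combination (z 0 ^ 2) * s3
  have hn' : X ^ 2 + 3 * y ^ 2 < 4 := by rw [hXs, hy]; linarith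
  have e0 : ∀ a b : ℤ, √3 * (z - lat a b) 0 = X - 3 * a := by
    intro a b; simp [lat, hX]; linear_combination -(a : ℝ) * s3
  have e1 : ∀ a b : ℤ, (z - lat a b) 1 = y - a - 2 * b := by
    intro a b; simp [lat, hy]; ring
  have en : ∀ a b : ℤ, (X - 3 * a) ^ 2 + 3 * (y - a - 2 * b) ^ 2 ≤ X ^ 2 + 3 * y ^ 2 →
      ‖z - lat a b‖ ≤ l := by
    intro a b h
    refine le_trans ?_ hz
    rw [← sq_le_sq₀ (norm_nonneg _) (norm_nonneg _), nsq, nsq z, e1]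
    have : (X - 3 * a) ^ 2 = 3 * ((z - lat a b) 0) ^ 2 := by
      rw [← e0 a b]; linear_combination ((z - lat a b) 0 ^ 2) * s3
    rw [this, hXs] at h
    rw [← hy]
    linarith
  have fin1 : ∀ a b : ℤ, |a| ≤ 1 → |b| ≤ 1 → |y - a - 2 * b| ≤ 1 → |X - 3 * a| ≤ 1 →
      (X - 3 * a) ^ 2 + 3 * (y - a - 2 * b) ^ 2 ≤ X ^ 2 + 3 * y ^ 2 →
      ∃ a b : ℤ, |a| ≤ 1 ∧ |b| ≤ 1 ∧ z - lat a b ∈ regularHexagon ∧ ‖z - lat a b‖ ≤ l :=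
    fun a b ha hb h1 h2 h3 => ⟨a, b, ha, hb, rect1 _ (by rwa [e1]) (by rwa [e0]), en a b h3⟩
  have fin0 : ∀ a b : ℤ, |a| ≤ 1 → |b| ≤ 1 → |(X - 3 * a + (y - a - 2 * b)) / 2| ≤ 1 →
      |(X - 3 * a - 3 * (y - a - 2 * b)) / 2| ≤ 1 →
      (X - 3 * a) ^ 2 + 3 * (y - a - 2 * b) ^ 2 ≤ X ^ 2 + 3 * y ^ 2 →
      ∃ a b : ℤ, |a| ≤ 1 ∧ |b| ≤ 1 ∧ z - lat a b ∈ regularHexagon ∧ ‖z - lat a b‖ ≤ l :=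
    fun a b ha hb h1 h2 h3 =>
      ⟨a, b, ha, hb, rect0 _ (by rwa [e1, e0]) (by rwa [e1, e0]), en a b h3⟩
  have fin2 : ∀ a b : ℤ, |a| ≤ 1 → |b| ≤ 1 → |(-(X - 3 * a) + (y - a - 2 * b)) / 2| ≤ 1 →
      |(-(X - 3 * a) - 3 * (y - a - 2 * b)) / 2| ≤ 1 →
      (X - 3 * a) ^ 2 + 3 * (y - a - 2 * b) ^ 2 ≤ X ^ 2 + 3 * y ^ 2 →
      ∃ a b : ℤ, |a| ≤ 1 ∧ |b| ≤ 1 ∧ z - lat a b ∈ regularHexagon ∧ ‖z - lat a b‖ ≤ l :=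
    fun a b ha hb h1 h2 h3 =>
      ⟨a, b, ha, hb, rect2 _ (by rwa [e1, e0]) (by rwa [e1, e0]), en a b h3⟩
  clear en e0 e1 hXs hX hy hn hz
  by_cases c1 : |X| ≤ |y|
  · rcases le_or_gt |y| 1 with h | h
    · exact fin1 0 0 (by norm_num) (by norm_num) (by simpa using h) (by simpa using c1.trans h)
        (by simp)
    · have hX1 : |X| ≤ 1 := by
        rw [← sq_le_one_iff_abs_le_one]
        have : 1 < y ^ 2 := (one_lt_sq_iff_one_lt_abs y).2 h
        linarith
      have hy2 : |y| ≤ 2 := abs_le_of_sq_le_sq (by nlinarith [sq_nonneg X]) (by norm_num)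
      rw [abs_le] at hX1 hy2
      rcases lt_abs.1 h with h | h
      · refine fin1 0 1 (by norm_num) (by norm_num) ?_ ?_ ?_ <;> push_cast
        · rw [abs_le]; constructor <;> linarith
        · rw [abs_le]; constructor <;> linarith
        · nlinarith
      · refine fin1 0 (-1) (by norm_num) (by norm_num) ?_ ?_ ?_ <;> push_cast
        · rw [abs_le]; constructor <;> linarith
        · rw [abs_le]; constructor <;> linarith
        · nlinarith
  · rw [not_le] at c1
    rcases le_total 0 (X * y) with hs | hs
    · have ht : |(X - 3 * y) / 2| ≤ |(X + y) / 2| := by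
        rw [← sq_le_sq]
        have h1 : |y| * |y| ≤ |X| * |y| := by gcongr
        rw [abs_mul_abs_self, ← abs_mul, abs_of_nonneg hs] at h1
        nlinarith
      rcases le_or_gt |(X + y) / 2| 1 with h | h
      · exact fin0 0 0 (by norm_num) (by norm_num) (by simpa using h) (by simpa using ht.trans h)
          (by simp)
      · have hid : X ^ 2 + 3 * y ^ 2 = 3 * ((X + y) / 2) ^ 2 + ((X - 3 * y) / 2) ^ 2 := by ring
        have hX1 : |(X - 3 * y) / 2| ≤ 1 := by
          rw [← sq_le_one_iff_abs_le_one]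
          have : 1 < ((X + y) / 2) ^ 2 := (one_lt_sq_iff_one_lt_abs _).2 h
          linarith
        have hy2 : |(X + y) / 2| ≤ 2 :=
          abs_le_of_sq_le_sq (by nlinarith [sq_nonneg ((X - 3 * y) / 2)]) (by norm_num)
        rw [abs_le] at hX1 hy2
        rcases lt_abs.1 h with h | h
        · refine fin0 1 0 (by norm_num) (by norm_num) ?_ ?_ ?_ <;> push_cast
          · rw [abs_le]; constructor <;> linarith
          · rw [abs_le]; constructor <;> linarith
          · nlinarith
        · refine fin0 (-1) 0 (by norm_num) (by norm_num) ?_ ?_ ?_ <;> push_cast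
          · rw [abs_le]; constructor <;> linarith
          · rw [abs_le]; constructor <;> linarith
          · nlinarith
    · have ht : |(-X - 3 * y) / 2| ≤ |(-X + y) / 2| := by
        rw [← sq_le_sq]
        have h1 : |y| * |y| ≤ |X| * |y| := by gcongr
        rw [abs_mul_abs_self, ← abs_mul, abs_of_nonpos hs] at h1
        nlinarith
      rcases le_or_gt |(-X + y) / 2| 1 with h | h
      · exact fin2 0 0 (by norm_num) (by norm_num) (by simpa using h) (by simpa using ht.trans h)
          (by simp)
      · have hid : X ^ 2 + 3 * y ^ 2 = 3 * ((-X + y) / 2) ^ 2 + ((-X - 3 * y) / 2) ^ 2 := by ring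
        have hX1 : |(-X - 3 * y) / 2| ≤ 1 := by
          rw [← sq_le_one_iff_abs_le_one]
          have : 1 < ((-X + y) / 2) ^ 2 := (one_lt_sq_iff_one_lt_abs _).2 h
          linarith
        have hy2 : |(-X + y) / 2| ≤ 2 :=
          abs_le_of_sq_le_sq (by nlinarith [sq_nonneg ((-X - 3 * y) / 2)]) (by norm_num)
        rw [abs_le] at hX1 hy2
        rcases lt_abs.1 h with h | h
        · refine fin2 (-1) 1 (by norm_num) (by norm_num) ?_ ?_ ?_ <;> push_cast
          · rw [abs_le]; constructor <;> linarith
          · rw [abs_le]; constructor <;> linarith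
          · nlinarith
        · refine fin2 1 (-1) (by norm_num) (by norm_num) ?_ ?_ ?_ <;> push_cast
          · rw [abs_le]; constructor <;> linarith
          · rw [abs_le]; constructor <;> linarith
          · nlinarith

noncomputable def nb : Fin 6 → EuclideanSpace ℝ (Fin 2) :=
  ![!₂[√3, 1], !₂[0, 2], !₂[-√3, 1], !₂[-√3, -1], !₂[0, -2], !₂[√3, -1]]

lemma nb_sq (k : Fin 6) : nb k 0 ^ 2 + nb k 1 ^ 2 = 4 := by
  fin_cases k <;> simp [nb] <;> norm_num

lemma nb_norm (k : Fin 6) : ‖nb k‖ = 2 := by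
  rw [← sq_eq_sq₀ (norm_nonneg _) (by norm_num), nsq, nb_sq]; norm_num

lemma nb_inner (i j : Fin 6) (h : i ≠ j) : nb i 0 * nb j 0 + nb i 1 * nb j 1 ≤ 2 := by
  fin_cases i <;> fin_cases j <;> simp [nb] at h ⊢ <;> nlinarith [s3]

lemma nb_lt (k : Fin 6) (z : EuclideanSpace ℝ (Fin 2)) (h : ‖z - nb k‖ < ‖z‖) :
    2 < nb k 0 * z 0 + nb k 1 * z 1 := by
  rw [← sq_lt_sq₀ (norm_nonneg _) (norm_nonneg _), nsq, nsq] at h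
  simp only [PiLp.sub_apply] at h
  nlinarith [nb_sq k]

lemma hex_vol (l : ℝ) (hl : 3 * l ^ 2 < 4) :
    volume (regularHexagon ∩ closedBall 0 l) + 6 * volume (stdCap l 1) ≤
      volume (closedBall (0 : EuclideanSpace ℝ (Fin 2)) l) := by
  let oc : Fin 6 → Set (EuclideanSpace ℝ (Fin 2)) := fun k => {z | ‖z‖ ≤ l ∧ ‖z - nb k‖ < ‖z‖}
  have hocm : ∀ k, MeasurableSet (oc k) := by
    intro k
    apply MeasurableSet.inter
    · exact (isClosed_le continuous_norm continuous_const).measurableSet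
    · exact (isOpen_lt (f := fun z : EuclideanSpace ℝ (Fin 2) => ‖z - nb k‖) (g := fun z => ‖z‖)
        (by fun_prop) (by fun_prop)).measurableSet
  have hocv : ∀ k, volume (stdCap l 1) ≤ volume (oc k) := by
    intro k
    have h1 := cap_vol l (nb k) (by rw [nb_norm]; norm_num)
    rw [nb_norm] at h1
    norm_num at h1
    rw [← h1]
    have hsub : capSet l (nb k) ⊆ oc k ∪ {z | ‖z - nb k‖ = ‖z‖} := by
      rintro z ⟨a, b⟩
      rcases b.lt_or_eq with h | h
      · left; exact ⟨a, h⟩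
      · right; exact h
    calc _ ≤ _ := measure_mono hsub
      _ ≤ _ := measure_union_le _ _
      _ = _ := by rw [line_null _ (by rw [nb_norm]; norm_num), add_zero]
  have hdisj : Pairwise (Function.onFun Disjoint oc) := by
    intro i j hij
    rw [Function.onFun, Set.disjoint_left]
    rintro z ⟨hz, hi⟩ ⟨_, hj⟩
    have h1 := nb_lt i z hi
    have h2 := nb_lt j z hj
    have h3 := nb_inner i j hij
    have h4 := nb_sq i
    have h5 := nb_sq j
    have hn : ‖z‖ ^ 2 ≤ l ^ 2 := by gcongr
    rw [nsq] at hn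
    have h6 : 4 < (nb i 0 + nb j 0) * z 0 + (nb i 1 + nb j 1) * z 1 := by linarith
    have h7 : (nb i 0 + nb j 0) ^ 2 + (nb i 1 + nb j 1) ^ 2 ≤ 12 := by nlinarith
    have h8 : ((nb i 0 + nb j 0) * z 0 + (nb i 1 + nb j 1) * z 1) ^ 2 ≤
        ((nb i 0 + nb j 0) ^ 2 + (nb i 1 + nb j 1) ^ 2) * (z 0 ^ 2 + z 1 ^ 2) := by
      nlinarith [sq_nonneg ((nb i 0 + nb j 0) * z 1 - (nb i 1 + nb j 1) * z 0)]
    have h9 : ((nb i 0 + nb j 0) ^ 2 + (nb i 1 + nb j 1) ^ 2) * (z 0 ^ 2 + z 1 ^ 2) ≤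
        12 * (z 0 ^ 2 + z 1 ^ 2) := by gcongr
    nlinarith
  have hd2 : Disjoint (regularHexagon ∩ closedBall 0 l) (⋃ k, oc k) := by
    rw [Set.disjoint_left]
    rintro z ⟨hz, _⟩ hz2
    rw [Set.mem_iUnion] at hz2
    obtain ⟨k, _, hk⟩ := hz2
    have h1 := nb_lt k z hk
    have := hex_half (nb k 0) (nb k 1) (by
      intro j
      fin_cases k <;> fin_cases j <;> simp [nb, hv] <;> nlinarith [s3]) z hz
    linarith
  calc _ ≤ volume (regularHexagon ∩ closedBall 0 l) + volume (⋃ k, oc k) := by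
        gcongr
        rw [measure_iUnion hdisj hocm, tsum_fintype]
        calc _ = ∑ k : Fin 6, volume (stdCap l 1) := by simp
          _ ≤ _ := Finset.sum_le_sum fun k _ => hocv k
    _ = volume ((regularHexagon ∩ closedBall 0 l) ∪ ⋃ k, oc k) :=
        (measure_union hd2 (MeasurableSet.iUnion hocm)).symm
    _ ≤ _ := by
        apply measure_mono
        apply Set.union_subset Set.inter_subset_right
        apply Set.iUnion_subset
        rintro k z ⟨h, _⟩
        simpa using h

lemma ball_finite (l : ℝ) (x : EuclideanSpace ℝ (Fin 2)) : volume (closedBall x l) ≠ ⊤ :=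
  (isCompact_closedBall x l).measure_lt_top.ne

lemma cell_bound (l : ℝ) (hl0 : 0 ≤ l) (hl : 3 * l ^ 2 < 4) (n : ℕ)
    (c : Fin n → EuclideanSpace ℝ (Fin 2)) (hc : ∀ j k : Fin n, j ≠ k → 2 ≤ ‖c j - c k‖) :
    n * volume (regularHexagon ∩ closedBall 0 l) ≤ volume (⋃ i, closedBall (c i) l) := by
  classical
  have hl' : l < 1.155 := by
    by_contra hcon; rw [not_lt] at hcon; norm_num at hcon; nlinarith
  let V : Fin n → Set (EuclideanSpace ℝ (Fin 2)) := fun i =>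
    closedBall (c i) l \ ⋃ j ∈ Finset.univ.erase i, (fun z => z + (-c i)) ⁻¹' capSet l (c j - c i)
  have hpm : ∀ i j, MeasurableSet ((fun z => z + (-c i)) ⁻¹' capSet l (c j - c i)) := fun i j =>
    (measurable_add_const _) (meas_capSet _ _)
  have hVm : ∀ i, MeasurableSet (V i) := fun i =>
    measurableSet_closedBall.diff (Finset.measurableSet_biUnion _ fun j _ => hpm i j)
  have hVd : Pairwise (Function.onFun Disjoint V) := by
    intro i j hij
    rw [Function.onFun, Set.disjoint_left]
    rintro z ⟨h1, h2⟩ ⟨h3, h4⟩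
    simp only [Set.mem_iUnion, Set.mem_preimage, not_exists, Finset.mem_erase, Finset.mem_univ,
      and_true, capSet, Set.mem_ofPred_eq, not_and, not_le] at h2 h4
    rw [mem_closedBall, dist_eq_norm] at h1 h3
    have h5 := h2 j hij.symm (by rwa [← sub_eq_add_neg])
    have h6 := h4 i hij (by rwa [← sub_eq_add_neg])
    rw [show z + -c i - (c j - c i) = z - c j by abel, ← sub_eq_add_neg] at h5
    rw [show z + -c j - (c i - c j) = z - c i by abel, ← sub_eq_add_neg] at h6
    linarith
  have hVv : ∀ i, volume (regularHexagon ∩ closedBall 0 l) ≤ volume (V i) := by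
    intro i
    have hfin : 6 * volume (stdCap l 1) ≠ ⊤ := by
      have : stdCap l 1 ⊆ closedBall 0 l := fun z hz => by simpa using hz.1
      exact ENNReal.mul_ne_top (by norm_num) (measure_ne_top_of_subset this (ball_finite l 0))
    have h1 : volume (closedBall (c i) l) ≤ volume (V i) + 6 * volume (stdCap l 1) := by
      calc volume (closedBall (c i) l) ≤ volume (V i ∪ ⋃ j ∈ Finset.univ.erase i,
            (fun z => z + (-c i)) ⁻¹' capSet l (c j - c i)) := by
              apply measure_mono
              simp only [V, Set.sdiff_union_self]
              exact Set.subset_union_left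
        _ ≤ volume (V i) + volume (⋃ j ∈ Finset.univ.erase i,
            (fun z => z + (-c i)) ⁻¹' capSet l (c j - c i)) := measure_union_le _ _
        _ ≤ volume (V i) + ∑ j ∈ Finset.univ.erase i,
            volume ((fun z => z + (-c i)) ⁻¹' capSet l (c j - c i)) := by
              gcongr; exact measure_biUnion_finset_le _ _
        _ = volume (V i) + ∑ j ∈ Finset.univ.erase i, volume (capSet l (c j - c i)) := by
              simp only [measure_preimage_add_right]
        _ ≤ _ := by
              gcongr
              apply local_bound l hl'
              · intro j hj; exact hc j i (Finset.ne_of_mem_erase hj)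
              · intro j hj k hk hjk
                rw [sub_sub_sub_cancel_right]; exact hc j k hjk
    have h2 := hex_vol l hl
    have h3 : volume (closedBall (c i) l) =
        volume (closedBall (0 : EuclideanSpace ℝ (Fin 2)) l) := by
      rw [Measure.addHaar_closedBall_center]
    rw [h3] at h1
    exact (ENNReal.add_le_add_iff_right hfin).1 (h2.trans h1)
  calc _ = ∑ i : Fin n, volume (regularHexagon ∩ closedBall 0 l) := by simp
    _ ≤ ∑ i, volume (V i) := Finset.sum_le_sum fun i _ => hVv i
    _ = volume (⋃ i, V i) := by rw [measure_iUnion hVd hVm, tsum_fintype]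
    _ ≤ _ := measure_mono (Set.iUnion_mono fun i => Set.sdiff_subset)

lemma lat_sub (a b c d : ℤ) : lat a b - lat c d = lat (a - c) (b - d) := by
  ext i; fin_cases i <;> simp [lat] <;> ring

lemma lat_norm (a b : ℤ) (h : a ≠ 0 ∨ b ≠ 0) : 2 ≤ ‖lat a b‖ := by
  rw [← sq_le_sq₀ (by norm_num) (norm_nonneg _), nsq]
  have h1 : (1 : ℤ) ≤ a ^ 2 + a * b + b ^ 2 := by
    have : 0 < a ^ 2 + a * b + b ^ 2 := by
      rcases h with h | h
      · have : 0 < a ^ 2 := by positivity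
        nlinarith [sq_nonneg (a + 2 * b)]
      · have : 0 < b ^ 2 := by positivity
        nlinarith [sq_nonneg (2 * a + b)]
    omega
  have h2 : (1 : ℝ) ≤ (a : ℝ) ^ 2 + a * b + b ^ 2 := by exact_mod_cast h1
  have e : lat a b 0 ^ 2 + lat a b 1 ^ 2 = 4 * ((a : ℝ) ^ 2 + a * b + b ^ 2) := by
    simp [lat]; linear_combination (a : ℝ) ^ 2 * s3
  rw [e]; linarith

lemma lat_cover (l : ℝ) (hl0 : 0 ≤ l) (hl : 3 * l ^ 2 < 4) (m : ℕ) (ι : Type) (f : ι → Fin m × Fin m) :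
    volume (⋃ i, closedBall (lat (f i).1 (f i).2) l) ≤
      ((m + 2 : ℕ) ^ 2 : ℕ) * volume (regularHexagon ∩ closedBall 0 l) := by
  let S : Finset (ℤ × ℤ) := Finset.Icc (-1) (m : ℤ) ×ˢ Finset.Icc (-1) (m : ℤ)
  have hS : S.card = (m + 2) ^ 2 := by
    simp only [S, Finset.card_product, Int.card_Icc]
    rw [show ((m : ℤ) + 1 - -1) = ((m + 2 : ℕ) : ℤ) by push_cast; ring, Int.toNat_natCast, sq]
  have hsub : (⋃ i, closedBall (lat (f i).1 (f i).2) l) ⊆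
      ⋃ p ∈ S, (fun z => z + (-lat p.1 p.2)) ⁻¹' (regularHexagon ∩ closedBall 0 l) := by
    apply Set.iUnion_subset
    intro i z hz
    rw [mem_closedBall, dist_eq_norm] at hz
    obtain ⟨a, b, ha, hb, h1, h2⟩ := cover_core l hl0 hl _ hz
    rw [abs_le] at ha hb
    have e : z - lat (f i).1 (f i).2 - lat a b = z + -lat ((f i).1 + a) ((f i).2 + b) := by
      ext j; fin_cases j <;> simp [lat] <;> ring
    rw [e] at h1 h2
    simp only [Set.mem_iUnion]
    refine ⟨((f i).1 + a, (f i).2 + b), ?_, h1, by simpa using h2⟩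
    have := (f i).1.2
    have := (f i).2.2
    simp only [S, Finset.mem_product, Finset.mem_Icc]
    omega
  calc _ ≤ _ := measure_mono hsub
    _ ≤ ∑ p ∈ S, volume ((fun z => z + (-lat p.1 p.2)) ⁻¹' (regularHexagon ∩ closedBall 0 l)) :=
      measure_biUnion_finset_le _ _
    _ = _ := by simp only [measure_preimage_add_right, Finset.sum_const, hS, nsmul_eq_mul]

/-- For `0 < λ < 2/√3 - 1`, `limsup_{n→∞} δ₂(n, λ) = π / vol₂(H ∩ (1+λ)B²)`, where `H` is the
regular hexagon centered at the origin circumscribed about the unit disk. -/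
theorem planar_density_outer_parallel (lam : ℝ) (hlam0 : 0 < lam)
    (hlam1 : lam < 2 / Real.sqrt 3 - 1) :
    Filter.limsup (fun n : ℕ => deltaTwo n lam) Filter.atTop =
      Real.pi /
        (volume (regularHexagon ∩ closedBall (0 : EuclideanSpace ℝ (Fin 2)) (1 + lam))).toReal := by
  have hl0 : 0 ≤ 1 + lam := by linarith
  have hl : 3 * (1 + lam) ^ 2 < 4 := by
    have h1 : 1 + lam < 2 / √3 := by linarith
    have h2 : (1 + lam) ^ 2 < (2 / √3) ^ 2 := by gcongr
    rw [div_pow, Real.sq_sqrt (by norm_num)] at h2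
    linarith
  set l := 1 + lam with hldef
  set A := volume (regularHexagon ∩ closedBall (0 : EuclideanSpace ℝ (Fin 2)) l) with hA
  have hAfin : A ≠ ⊤ := measure_ne_top_of_subset Set.inter_subset_right (ball_finite l 0)
  have hA0 : A ≠ 0 := by
    intro h
    have h1 := lat_cover l hl0 hl 1 Unit (fun _ => (0, 0))
    rw [← hA, h, mul_zero, nonpos_iff_eq_zero] at h1
    have h2 : 0 < volume (⋃ _ : Unit, closedBall (lat ((0 : Fin 1) : ℕ) ((0 : Fin 1) : ℕ)) l) := by
      refine lt_of_lt_of_le (measure_closedBall_pos volume (lat ((0 : Fin 1) : ℕ) ((0 : Fin 1) : ℕ))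
        (r := l) (by linarith)) (measure_mono ?_)
      exact Set.subset_iUnion (fun _ : Unit => closedBall (lat ((0 : Fin 1) : ℕ) ((0 : Fin 1) : ℕ)) l) ()
    exact h2.ne' h1
  have hAr : 0 < A.toReal := ENNReal.toReal_pos hA0 hAfin
  have hUfin : ∀ (n : ℕ) (c : Fin n → EuclideanSpace ℝ (Fin 2)),
      volume (⋃ i, closedBall (c i) l) ≠ ⊤ := by
    intro n c
    exact (isCompact_iUnion fun i => isCompact_closedBall (c i) l).measure_lt_top.ne
  have hub : ∀ (n : ℕ) (c : Fin n → EuclideanSpace ℝ (Fin 2)),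
      (∀ j k : Fin n, j ≠ k → 2 ≤ ‖c j - c k‖) →
      (n : ℝ) * Real.pi / (volume (⋃ i : Fin n, closedBall (c i) l)).toReal ≤
        Real.pi / A.toReal := by
    intro n c hc
    have h1 := ENNReal.toReal_mono (hUfin n c) (cell_bound l hl0 hl n c hc)
    rw [ENNReal.toReal_mul, ENNReal.toReal_natCast, ← hA] at h1
    rcases Nat.eq_zero_or_pos n with rfl | hn
    · simp; positivity
    · have hn' : (0 : ℝ) < n := by exact_mod_cast hn
      have : 0 < n * A.toReal := by positivity
      rw [div_le_div_iff₀ (by linarith) hAr]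
      nlinarith [Real.pi_pos]
  have hub' : ∀ n, deltaTwo n lam ≤ Real.pi / A.toReal := by
    intro n
    apply Real.sSup_le
    · rintro x ⟨c, hc, rfl⟩
      exact hub n c hc
    · positivity
  have hnn : ∀ n, 0 ≤ deltaTwo n lam := by
    intro n
    apply Real.sSup_nonneg
    rintro x ⟨c, hc, rfl⟩
    positivity
  have hlow : ∀ m : ℕ, 0 < m →
      Real.pi / A.toReal * ((m : ℝ) / (m + 2)) ^ 2 ≤ deltaTwo (m * m) lam := by
    intro m hm
    let f : Fin (m * m) → Fin m × Fin m := finProdFinEquiv.symm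
    let c : Fin (m * m) → EuclideanSpace ℝ (Fin 2) := fun i => lat (f i).1 (f i).2
    have hc : ∀ j k, j ≠ k → 2 ≤ ‖c j - c k‖ := by
      intro j k hjk
      simp only [c]
      rw [lat_sub]
      apply lat_norm
      by_contra hcon
      rw [not_or, not_not, not_not] at hcon
      apply hjk
      apply finProdFinEquiv.symm.injective
      apply Prod.ext <;> apply Fin.ext
      · have := hcon.1; simp only [f] at this; omega
      · have := hcon.2; simp only [f] at this; omega
    have hle : ((m * m : ℕ) : ℝ) * Real.pi / (volume (⋃ i, closedBall (c i) l)).toReal ≤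
        deltaTwo (m * m) lam := by
      apply le_csSup
      · refine ⟨Real.pi / A.toReal, ?_⟩
        rintro x ⟨c, hc, rfl⟩
        exact hub _ c hc
      · exact ⟨c, hc, rfl⟩
    refine le_trans ?_ hle
    have h1 := ENNReal.toReal_mono (ENNReal.mul_ne_top (ENNReal.natCast_ne_top _) hAfin)
      (lat_cover l hl0 hl m _ f)
    rw [ENNReal.toReal_mul, ENNReal.toReal_natCast] at h1
    have h2 := ENNReal.toReal_mono (hUfin _ c) (cell_bound l hl0 hl _ c hc)
    rw [ENNReal.toReal_mul, ENNReal.toReal_natCast, ← hA] at h2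
    have hm' : (0 : ℝ) < m := by exact_mod_cast hm
    have h3 : 0 < (volume (⋃ i, closedBall (c i) l)).toReal := by
      refine lt_of_lt_of_le ?_ h2
      push_cast; positivity
    calc Real.pi / A.toReal * ((m : ℝ) / (m + 2)) ^ 2
        = ((m * m : ℕ) : ℝ) * Real.pi / ((((m + 2 : ℕ) ^ 2 : ℕ) : ℝ) * A.toReal) := by
          push_cast; field_simp
      _ ≤ _ := by
          apply div_le_div_of_nonneg_left _ h3 h1
          positivity
  have hbdd : Filter.IsBoundedUnder (· ≤ ·) Filter.atTop (fun n : ℕ => deltaTwo n lam) :=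
    Filter.isBoundedUnder_of ⟨_, hub'⟩
  have hcob : Filter.IsCoboundedUnder (· ≤ ·) Filter.atTop (fun n : ℕ => deltaTwo n lam) :=
    (Filter.isBoundedUnder_of (r := (· ≥ ·)) ⟨0, hnn⟩).isCoboundedUnder_le
  apply le_antisymm
  · exact Filter.limsup_le_of_le hcob (Filter.Eventually.of_forall hub')
  · apply le_of_forall_lt
    intro b hb
    obtain ⟨b', hb1, hb2⟩ := exists_between hb
    refine lt_of_lt_of_le hb1 ?_
    apply Filter.le_limsup_of_frequently_le _ hbdd
    have ht : Filter.Tendsto (fun m : ℕ => Real.pi / A.toReal * ((m : ℝ) / (m + 2)) ^ 2)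
        Filter.atTop (nhds (Real.pi / A.toReal)) := by
      have := ((tendsto_natCast_div_add_atTop (2 : ℝ)).pow 2).const_mul (Real.pi / A.toReal)
      simpa using this
    have hev := (ht.eventually (lt_mem_nhds hb2)).and (Filter.eventually_gt_atTop 0)
    have hmm : Filter.Tendsto (fun m : ℕ => m * m) Filter.atTop Filter.atTop :=
      Filter.tendsto_atTop_mono (fun m => Nat.le_mul_self m) Filter.tendsto_id
    apply hmm.frequently
    apply Filter.Eventually.frequently
    filter_upwards [hev] with m hm
    exact hm.1.le.trans (hlow m hm.2)
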